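/- arXiv:2309.02412 — 2 statements merged into one kernel-verified Lean document; each statement's English description precedes it below -/
import Mathlib

section
/- Let σ ≥ 2L, x ∈ Q, z ∈ ℝⁿ, and suppose ψ is twice differentiable. Let x⁺ ∈ Q satisfy ‖∇M_{x,σ}(x⁺) + ψ'(x⁺)‖ ≤ (σ/4)‖x⁺ − x‖² for some ψ'(x⁺) ∈ ∂ψ(x⁺), M_{x,σ}(x⁺) + ψ(x⁺) ≤ F(x), and additionally B + σ‖x⁺ − x‖·I + ∇²ψ(x⁺) ⪰ 0. Suppose ‖g − ∇f(x)‖ ≤ δ_g and ‖B − ∇²f(z)‖ ≤ δ_B for some δ_g, δ_B ≥ 0. Then F(x) − F(x⁺) ≥ max{ (1/(192·σ^{1/2}))·‖∇f(x⁺) + ψ'(x⁺)‖^{3/2}, (1/(2·3⁶·σ²))·ξ(x⁺)³ } + (σ/48)‖x⁺ − x‖³ − (171/σ²)(δ_B³ + L³‖x − z‖³) − (3/σ^{1/2})·δ_g^{3/2}. -/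
open RealInnerProductSpace

/-- `negEigPart F y` is ξ(y) = max{−λ_min(∇²F(y)), 0}, defined as the least `c ≥ 0` such
that `∇²F(y) ⪰ −c·I`. -/
noncomputable def negEigPart {n : ℕ} (F : EuclideanSpace ℝ (Fin n) → ℝ)
    (y : EuclideanSpace ℝ (Fin n)) : ℝ :=
  sInf {c : ℝ | 0 ≤ c ∧ ∀ v : EuclideanSpace ℝ (Fin n),
    -(c * ‖v‖ ^ 2) ≤ ⟪fderiv ℝ (gradient F) y v, v⟫}

section helpers

variable {n : ℕ}

lemma aux_grad_differentiable (f : EuclideanSpace ℝ (Fin n) → ℝ) (hf : ContDiff ℝ 2 f) :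
    Differentiable ℝ (gradient f) := by
  have h1 : ContDiff ℝ 1 (fderiv ℝ f) := hf.fderiv_right (by norm_num)
  have h2 : Differentiable ℝ (fderiv ℝ f) := h1.differentiable (by norm_num)
  have h3 := (InnerProductSpace.toDual ℝ (EuclideanSpace ℝ (Fin n))).symm.toContinuousLinearEquiv.differentiable
  exact h3.comp h2

lemma aux_hasGradient (f : EuclideanSpace ℝ (Fin n) → ℝ) (hf : ContDiff ℝ 2 f)
    (x : EuclideanSpace ℝ (Fin n)) : HasGradientAt f (gradient f x) x :=
  (hf.differentiable (by norm_num) x).hasGradientAt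

lemma aux_grad_taylor (f : EuclideanSpace ℝ (Fin n) → ℝ) (L : ℝ) (hf : ContDiff ℝ 2 f)
    (hLip : ∀ u v : EuclideanSpace ℝ (Fin n),
      ‖fderiv ℝ (gradient f) v - fderiv ℝ (gradient f) u‖ ≤ L * ‖v - u‖)
    (x h : EuclideanSpace ℝ (Fin n)) :
    ∀ t ∈ Set.Icc (0:ℝ) 1,
    ‖gradient f (x + t • h) - gradient f x - t • (fderiv ℝ (gradient f) x h)‖
      ≤ L * ‖h‖ ^ 2 / 2 * t ^ 2 := by
  have hd := aux_grad_differentiable f hf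
  have hline : ∀ t : ℝ, HasDerivAt (fun t : ℝ => x + t • h) h t := by
    intro t
    simpa using ((hasDerivAt_id t).smul_const h).const_add x
  have hφ : ∀ t : ℝ, HasDerivAt
      (fun t : ℝ => gradient f (x + t • h) - gradient f x - t • (fderiv ℝ (gradient f) x h))
      (fderiv ℝ (gradient f) (x + t • h) h - fderiv ℝ (gradient f) x h) t := by
    intro t
    have h1 := (hd (x + t • h)).hasFDerivAt.comp_hasDerivAt t (hline t)
    have h2 := (hasDerivAt_id t).smul_const (fderiv ℝ (gradient f) x h)
    refine ((h1.sub_const (gradient f x)).sub h2).congr_deriv ?_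
    simp
  refine image_norm_le_of_norm_deriv_right_le_deriv_boundary
    (f' := fun t => fderiv ℝ (gradient f) (x + t • h) h - fderiv ℝ (gradient f) x h)
    (B' := fun t => L * ‖h‖ ^ 2 * t)
    (fun t _ => (hφ t).continuousAt.continuousWithinAt)
    (fun t _ => (hφ t).hasDerivWithinAt) ?_ ?_ ?_
  · simp
  · intro t
    have := ((hasDerivAt_id t).pow 2).const_mul (L * ‖h‖ ^ 2 / 2)
    refine (this.congr_deriv ?_)
    simp; ring
  · intro t ht
    have h1 := hLip x (x + t • h)
    rw [add_sub_cancel_left, norm_smul, Real.norm_of_nonneg ht.1] at h1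
    rw [← ContinuousLinearMap.sub_apply]
    refine (ContinuousLinearMap.le_opNorm _ _).trans ?_
    calc _ ≤ L * (t * ‖h‖) * ‖h‖ := by gcongr
      _ = _ := by ring

lemma aux_taylor (f : EuclideanSpace ℝ (Fin n) → ℝ) (L : ℝ) (hf : ContDiff ℝ 2 f)
    (hLip : ∀ u v : EuclideanSpace ℝ (Fin n),
      ‖fderiv ℝ (gradient f) v - fderiv ℝ (gradient f) u‖ ≤ L * ‖v - u‖)
    (x h : EuclideanSpace ℝ (Fin n)) :
    f (x + h) - f x - ⟪gradient f x, h⟫ - 1 / 2 * ⟪fderiv ℝ (gradient f) x h, h⟫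
      ≤ L / 6 * ‖h‖ ^ 3 := by
  have hline : ∀ t : ℝ, HasDerivAt (fun t : ℝ => x + t • h) h t := by
    intro t
    simpa using ((hasDerivAt_id t).smul_const h).const_add x
  have hφ : ∀ t : ℝ, HasDerivAt
      (fun t : ℝ => f (x + t • h) - f x - t * ⟪gradient f x, h⟫
        - t ^ 2 * (1 / 2 * ⟪fderiv ℝ (gradient f) x h, h⟫))
      ⟪gradient f (x + t • h) - gradient f x - t • (fderiv ℝ (gradient f) x h), h⟫ t := by
    intro t
    have h1 := (aux_hasGradient f hf (x + t • h)).hasFDerivAt.comp_hasDerivAt t (hline t)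
    have h2 := (hasDerivAt_id t).mul_const ⟪gradient f x, h⟫
    have h3 := ((hasDerivAt_id t).pow 2).mul_const (1 / 2 * ⟪fderiv ℝ (gradient f) x h, h⟫)
    refine (((h1.sub_const (f x)).sub h2).sub h3).congr_deriv ?_
    simp [inner_sub_left, inner_smul_left]
    ring
  have key := image_norm_le_of_norm_deriv_right_le_deriv_boundary
    (f := fun t : ℝ => f (x + t • h) - f x - t * ⟪gradient f x, h⟫
        - t ^ 2 * (1 / 2 * ⟪fderiv ℝ (gradient f) x h, h⟫))
    (f' := fun t : ℝ => ⟪gradient f (x + t • h) - gradient f x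
      - t • (fderiv ℝ (gradient f) x h), h⟫) (a := 0) (b := 1)
    (B := fun t : ℝ => L / 6 * ‖h‖ ^ 3 * t ^ 3)
    (B' := fun t => L / 2 * ‖h‖ ^ 3 * t ^ 2)
    (fun t _ => (hφ t).continuousAt.continuousWithinAt)
    (fun t _ => (hφ t).hasDerivWithinAt) (by simp) ?_ ?_
  · have := key (x := 1) (by simp)
    simp only [one_smul, one_mul, one_pow, mul_one] at this
    exact (le_abs_self _).trans this
  · intro t
    have := ((hasDerivAt_id t).pow 3).const_mul (L / 6 * ‖h‖ ^ 3)
    refine (this.congr_deriv ?_)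
    simp; ring
  · intro t ht
    have h1 := aux_grad_taylor f L hf hLip x h t ⟨ht.1, ht.2.le⟩
    refine (norm_inner_le_norm _ _).trans ?_
    calc _ ≤ L * ‖h‖ ^ 2 / 2 * t ^ 2 * ‖h‖ := by gcongr
      _ = _ := by ring

lemma aux_young1 (a b : ℝ) (ha : 0 ≤ a) (hb : 0 ≤ b) :
    b ^ 2 * a ≤ 19 / 1000 * a ^ 3 + 28 / 10 * b ^ 3 := by
  have h : 0 ≤ (b - a * (238/1000)) ^ 2 * (b + a * (119/1000)) := by positivity
  nlinarith [pow_nonneg ha 3, pow_nonneg hb 3, mul_nonneg (sq_nonneg a) hb,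
    mul_nonneg (sq_nonneg b) ha]

lemma aux_young2 (a e : ℝ) (ha : 0 ≤ a) (he : 0 ≤ e) :
    1 / 2 * e * a ^ 2 ≤ 21 / 1000 * a ^ 3 + 425 / 10 * e ^ 3 := by
  have h : 0 ≤ (e - a * (626/10000)) ^ 2 * (e + a * (1252/10000)) := by positivity
  nlinarith [pow_nonneg ha 3, pow_nonneg he 3, mul_nonneg (sq_nonneg a) he,
    mul_nonneg (sq_nonneg e) ha]

lemma aux_cube (a b : ℝ) (ha : 0 ≤ a) (hb : 0 ≤ b) : (a + b) ^ 3 ≤ 4 * (a ^ 3 + b ^ 3) := by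
  nlinarith [mul_nonneg (add_nonneg ha hb) (sq_nonneg (a - b))]

lemma aux_cube2 (a b : ℝ) (ha : 0 ≤ a) (hb : 0 ≤ b) :
    (a + b) ^ 3 ≤ 9 / 4 * a ^ 3 + 9 * b ^ 3 := by
  have h : 0 ≤ (a - 2 * b) ^ 2 * (5 * a + 8 * b) := by positivity
  nlinarith [h, pow_nonneg ha 3, pow_nonneg hb 3, mul_nonneg (sq_nonneg a) hb,
    mul_nonneg (sq_nonneg b) ha]

lemma aux_norm1 (p c e u : ℝ) (hp : 0 ≤ p) (hc : 0 ≤ c) (he : 0 ≤ e) (hu : 0 ≤ u)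
    (h : u ^ 2 ≤ p ^ 2 + c ^ 2 + e * p) :
    1 / 192 * u ^ 3 + c ^ 2 * p + 1 / 2 * e * p ^ 2
      ≤ 1 / 16 * p ^ 3 + 171 / 4 * e ^ 3 + 3 * c ^ 3 := by
  have h1 : u ≤ p + (e / 2 + c) := by
    refine (sq_le_sq₀ hu (by positivity)).1 ?_
    nlinarith [mul_nonneg hp hc, mul_nonneg he hc, sq_nonneg e]
  have h2 : u ^ 3 ≤ (p + (e / 2 + c)) ^ 3 := by gcongr
  have h3 := aux_cube2 p (e / 2 + c) hp (by positivity)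
  have h4 := aux_cube (e / 2) c (by positivity) hc
  have h5 := aux_young1 p c hp hc
  have h6 := aux_young2 p e hp he
  have := pow_nonneg hp 3
  have := pow_nonneg hc 3
  have := pow_nonneg he 3
  have h7 : (e / 2) ^ 3 = e ^ 3 / 8 := by ring
  rw [h7] at h4
  linarith

lemma aux_norm2 (p c e k : ℝ) (hp : 0 ≤ p) (hc : 0 ≤ c) (he : 0 ≤ e) (hk : 0 ≤ k)
    (h : k ≤ 3 / 2 * p + e) :
    1 / (2 * 3 ^ 6) * k ^ 3 + c ^ 2 * p + 1 / 2 * e * p ^ 2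
      ≤ 1 / 16 * p ^ 3 + 171 / 4 * e ^ 3 + 3 * c ^ 3 := by
  have h2 : k ^ 3 ≤ (3 / 2 * p + e) ^ 3 := by gcongr
  have h4 := aux_cube (3 / 2 * p) e (by positivity) he
  have h5 := aux_young1 p c hp hc
  have h6 := aux_young2 p e hp he
  have := pow_nonneg hp 3
  have := pow_nonneg hc 3
  have := pow_nonneg he 3
  have h7 : (3 / 2 * p) ^ 3 = 27 / 8 * p ^ 3 := by ring
  rw [h7] at h4
  norm_num
  linarith

lemma aux_rpow (a : ℝ) (ha : 0 ≤ a) : a ^ ((3 : ℝ) / 2) = (Real.sqrt a) ^ 3 := by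
  rw [Real.sqrt_eq_rpow, ← Real.rpow_natCast, ← Real.rpow_mul ha]
  norm_num

lemma aux_final (r d e G k σ S D : ℝ) (hr : 0 ≤ r) (hd : 0 ≤ d) (he : 0 ≤ e) (hG : 0 ≤ G)
    (hk : 0 ≤ k) (hσ : 0 < σ) (hS : e ^ 3 ≤ 4 * S)
    (hG' : G ≤ σ * r ^ 2 + d + e * r) (hk' : k ≤ 3 / 2 * σ * r + e)
    (hD : σ / 12 * r ^ 3 - d * r - 1 / 2 * e * r ^ 2 ≤ D) :
    D ≥ max (1 / (192 * Real.sqrt σ) * G ^ ((3 : ℝ) / 2)) (1 / (2 * 3 ^ 6 * σ ^ 2) * k ^ 3)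
        + σ / 48 * r ^ 3 - 171 / σ ^ 2 * S - 3 / Real.sqrt σ * d ^ ((3 : ℝ) / 2) := by
  rw [aux_rpow G hG, aux_rpow d hd]
  obtain ⟨s, hs, hsσ⟩ : ∃ s, 0 < s ∧ σ = s ^ 2 :=
    ⟨Real.sqrt σ, Real.sqrt_pos.2 hσ, (Real.sq_sqrt hσ.le).symm⟩
  obtain ⟨c, hc, hcd⟩ : ∃ c, 0 ≤ c ∧ d = (s * c) ^ 2 :=
    ⟨Real.sqrt d / s, by positivity, by rw [mul_div_cancel₀ _ hs.ne', Real.sq_sqrt hd]⟩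
  obtain ⟨u, hu, huG⟩ : ∃ u, 0 ≤ u ∧ G = (s * u) ^ 2 :=
    ⟨Real.sqrt G / s, by positivity, by rw [mul_div_cancel₀ _ hs.ne', Real.sq_sqrt hG]⟩
  obtain ⟨ε, hε, hεe⟩ : ∃ ε, 0 ≤ ε ∧ e = s ^ 2 * ε :=
    ⟨e / s ^ 2, by positivity, by field_simp⟩
  obtain ⟨κ, hκ, hκk⟩ : ∃ κ, 0 ≤ κ ∧ k = s ^ 2 * κ :=
    ⟨k / s ^ 2, by positivity, by field_simp⟩
  subst hsσ hcd huG hεe hκk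
  rw [Real.sqrt_sq hs.le, Real.sqrt_sq (by positivity), Real.sqrt_sq (by positivity)]
  have hs2 : 0 < s ^ 2 := by positivity
  have e1 : 1 / (192 * s) * (s * u) ^ 3 = s ^ 2 * (1 / 192 * u ^ 3) := by field_simp
  have e2 : 1 / (2 * 3 ^ 6 * (s ^ 2) ^ 2) * (s ^ 2 * κ) ^ 3 = s ^ 2 * (1 / (2 * 3 ^ 6) * κ ^ 3) := by
    field_simp
  have e3 : 3 / s * (s * c) ^ 3 = s ^ 2 * (3 * c ^ 3) := by field_simp
  have e4 : s ^ 2 * (171 / 4 * ε ^ 3) ≤ 171 / (s ^ 2) ^ 2 * S := by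
    have : 171 / (s ^ 2) ^ 2 * ((s ^ 2 * ε) ^ 3 / 4) ≤ 171 / (s ^ 2) ^ 2 * S := by
      gcongr; linarith
    refine le_trans (le_of_eq ?_) this
    field_simp
  rw [e1, e2, e3]
  have a1 : u ^ 2 ≤ r ^ 2 + c ^ 2 + ε * r := by
    refine le_of_mul_le_mul_left ?_ hs2
    linarith
  have a2 : κ ≤ 3 / 2 * r + ε := by
    refine le_of_mul_le_mul_left ?_ hs2
    linarith
  have b1 := mul_le_mul_of_nonneg_left (aux_norm1 r c ε u hr hc hε hu a1) hs2.le
  have b2 := mul_le_mul_of_nonneg_left (aux_norm2 r c ε κ hr hc hε hκ a2) hs2.le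
  have hm : max (s ^ 2 * (1 / 192 * u ^ 3)) (s ^ 2 * (1 / (2 * 3 ^ 6) * κ ^ 3))
      ≤ s ^ 2 * (1 / 16 * r ^ 3 + 171 / 4 * ε ^ 3 + 3 * c ^ 3 - c ^ 2 * r - 1 / 2 * ε * r ^ 2) := by
    apply max_le <;> linarith
  linarith

end helpers

/-- Theorem 1 of the paper, full version: functional progress of one inexact
cubic Newton step in terms of both the new (sub)gradient norm and the second-order
stationarity measure ξ. -/
theorem stmt_4 {n : ℕ} (hn : 1 ≤ n)
    (f ψ : EuclideanSpace ℝ (Fin n) → ℝ) (Q : Set (EuclideanSpace ℝ (Fin n)))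
    (L : ℝ) (hL : 0 ≤ L)
    (hf : ContDiff ℝ 2 f)
    (hLip : ∀ u v : EuclideanSpace ℝ (Fin n),
      ‖fderiv ℝ (gradient f) v - fderiv ℝ (gradient f) u‖ ≤ L * ‖v - u‖)
    (hψ2 : ContDiff ℝ 2 ψ) (hQconv : Convex ℝ Q) (hψ : ConvexOn ℝ Q ψ)
    (x : EuclideanSpace ℝ (Fin n)) (hx : x ∈ Q) (z : EuclideanSpace ℝ (Fin n))
    (σ δg δB : ℝ) (hσ : σ ≥ 2 * L) (hσ0 : 0 < σ) (hδg : 0 ≤ δg) (hδB : 0 ≤ δB)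
    (g : EuclideanSpace ℝ (Fin n))
    (B : EuclideanSpace ℝ (Fin n) →L[ℝ] EuclideanSpace ℝ (Fin n))
    (hBsym : ∀ u v : EuclideanSpace ℝ (Fin n), ⟪B u, v⟫ = ⟪u, B v⟫)
    (xp : EuclideanSpace ℝ (Fin n)) (hxp : xp ∈ Q)
    (ψp : EuclideanSpace ℝ (Fin n))
    (hψp : ∀ y : EuclideanSpace ℝ (Fin n), ψ xp + ⟪ψp, y - xp⟫ ≤ ψ y)
    (hmodel : ‖g + B (xp - x) + (σ / 2 * ‖xp - x‖) • (xp - x) + ψp‖ ≤ σ / 4 * ‖xp - x‖ ^ 2)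
    (hdec : f x + ⟪g, xp - x⟫ + 1 / 2 * ⟪B (xp - x), xp - x⟫ + σ / 6 * ‖xp - x‖ ^ 3
      + ψ xp ≤ f x + ψ x)
    (hPSD : ∀ v : EuclideanSpace ℝ (Fin n),
      0 ≤ ⟪B v, v⟫ + σ * ‖xp - x‖ * ‖v‖ ^ 2 + ⟪fderiv ℝ (gradient ψ) xp v, v⟫)
    (hg : ‖g - gradient f x‖ ≤ δg)
    (hB : ‖B - fderiv ℝ (gradient f) z‖ ≤ δB) :
    (f x + ψ x) - (f xp + ψ xp) ≥
      max (1 / (192 * Real.sqrt σ) * ‖gradient f xp + ψp‖ ^ ((3 : ℝ) / 2))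
          (1 / (2 * 3 ^ 6 * σ ^ 2) * (negEigPart (fun y => f y + ψ y) xp) ^ 3)
        + σ / 48 * ‖xp - x‖ ^ 3
        - 171 / σ ^ 2 * (δB ^ 3 + L ^ 3 * ‖x - z‖ ^ 3)
        - 3 / Real.sqrt σ * δg ^ ((3 : ℝ) / 2) := by
  obtain ⟨h, hh⟩ : ∃ h, h = xp - x := ⟨_, rfl⟩
  have hxph : xp = x + h := by rw [hh]; abel
  rw [← hh] at hmodel hdec hPSD ⊢
  set H := fderiv ℝ (gradient f) with hH
  have hr := norm_nonneg h
  have hLd : 0 ≤ L * ‖x - z‖ := by positivity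
  have hBx : ‖B - H x‖ ≤ δB + L * ‖x - z‖ := by
    have h1 := hLip z x
    have : B - H x = (B - H z) - (H x - H z) := by abel
    rw [this]
    exact (norm_sub_le _ _).trans (add_le_add hB h1)
  have hBh : ‖(B - H x) h‖ ≤ (δB + L * ‖x - z‖) * ‖h‖ :=
    (ContinuousLinearMap.le_opNorm _ _).trans (by gcongr)
  have hL3 : L * ‖h‖ ^ 3 ≤ σ / 2 * ‖h‖ ^ 3 := by gcongr; linarith
  have hL2 : L * ‖h‖ ^ 2 ≤ σ / 2 * ‖h‖ ^ 2 := by gcongr; linarith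
  have hL1 : L * ‖h‖ ≤ σ / 2 * ‖h‖ := by gcongr; linarith
  refine aux_final ‖h‖ δg (δB + L * ‖x - z‖) _ _ σ _ _ hr hδg (by positivity) (norm_nonneg _)
    (Real.sInf_nonneg fun c hc => hc.1) hσ0 ?_ ?_ ?_ ?_
  · have := aux_cube δB (L * ‖x - z‖) hδB hLd
    rwa [mul_pow] at this
  · have h1 := aux_grad_taylor f L hf hLip x h 1 (by simp)
    simp only [one_smul, one_pow, mul_one] at h1
    rw [← hxph] at h1
    have h2 : gradient f xp + ψp = (gradient f xp - gradient f x - H x h) - (g - gradient f x)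
        - (B - H x) h - (σ / 2 * ‖h‖) • h
        + (g + B h + (σ / 2 * ‖h‖) • h + ψp) := by
      rw [ContinuousLinearMap.sub_apply]; abel
    have h3 : ‖(σ / 2 * ‖h‖) • h‖ = σ / 2 * ‖h‖ ^ 2 := by
      rw [norm_smul, Real.norm_of_nonneg (by positivity)]; ring
    rw [h2]
    have t1 := norm_add_le ((gradient f xp - gradient f x - H x h) - (g - gradient f x)
        - (B - H x) h - (σ / 2 * ‖h‖) • h) (g + B h + (σ / 2 * ‖h‖) • h + ψp)
    have t2 := norm_sub_le ((gradient f xp - gradient f x - H x h) - (g - gradient f x)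
        - (B - H x) h) ((σ / 2 * ‖h‖) • h)
    have t3 := norm_sub_le ((gradient f xp - gradient f x - H x h) - (g - gradient f x))
        ((B - H x) h)
    have t4 := norm_sub_le (gradient f xp - gradient f x - H x h) (g - gradient f x)
    linarith
  · refine csInf_le ⟨0, fun c hc => hc.1⟩ ⟨by positivity, fun v => ?_⟩
    have hgr : gradient (fun y => f y + ψ y) = fun y => gradient f y + gradient ψ y := by
      funext y
      have h1 := (aux_hasGradient f hf y).hasFDerivAt.add (aux_hasGradient ψ hψ2 y).hasFDerivAt
      rw [← map_add] at h1
      exact (hasGradientAt_iff_hasFDerivAt.2 h1).gradient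
    have hs : fderiv ℝ (gradient (fun y => f y + ψ y)) xp
        = H xp + fderiv ℝ (gradient ψ) xp := by
      rw [hgr]
      exact fderiv_fun_add (aux_grad_differentiable f hf xp) (aux_grad_differentiable ψ hψ2 xp)
    rw [hs, ContinuousLinearMap.add_apply, inner_add_left]
    have h1 := hPSD v
    have h2 : ‖B - H xp‖ ≤ δB + L * ‖x - z‖ + σ / 2 * ‖h‖ := by
      have h3 := hLip x xp
      rw [← hh] at h3
      have : B - H xp = (B - H x) - (H xp - H x) := by abel
      rw [this]
      refine (norm_sub_le _ _).trans ?_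
      linarith
    have h4 : ⟪(B - H xp) v, v⟫ ≤ (δB + L * ‖x - z‖ + σ / 2 * ‖h‖) * ‖v‖ ^ 2 := by
      refine (real_inner_le_norm _ _).trans ?_
      calc _ ≤ (‖B - H xp‖ * ‖v‖) * ‖v‖ := by gcongr; exact ContinuousLinearMap.le_opNorm _ _
        _ = ‖B - H xp‖ * ‖v‖ ^ 2 := by ring
        _ ≤ _ := by gcongr
    rw [ContinuousLinearMap.sub_apply, inner_sub_left] at h4
    linarith
  · have h1 := aux_taylor f L hf hLip x h
    rw [← hxph] at h1
    have h2 : -(δg * ‖h‖) ≤ ⟪g - gradient f x, h⟫ := by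
      have := (abs_real_inner_le_norm (g - gradient f x) h).trans
        (mul_le_mul_of_nonneg_right hg hr)
      exact (abs_le.1 this).1
    have h3 : -((δB + L * ‖x - z‖) * ‖h‖ * ‖h‖) ≤ ⟪(B - H x) h, h⟫ := by
      have := (abs_real_inner_le_norm ((B - H x) h) h).trans
        (mul_le_mul_of_nonneg_right hBh hr)
      exact (abs_le.1 this).1
    rw [inner_sub_left] at h2
    rw [ContinuousLinearMap.sub_apply, inner_sub_left] at h3
    linarith
end

section
/- Let κ > 0, let N ≥ 1 be an integer, let m ≥ 1 be an integer, and let a₀, a₁, …, a_m be nonnegative real numbers satisfying a_{t+1} ≤ (1/κ)·(a_t + a₀)·a_t for every t = 0, …, m−1, and a₀/κ ≤ (1/2)^{N+1}. Then a_t/κ ≤ (1/2)^{(1+t)·N + 1} for every t = 0, 1, …, m. -/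
/-- the numeric induction lemma underlying the local superlinear
convergence analysis. -/
theorem stmt_18 (κ : ℝ) (hκ : 0 < κ) (N : ℕ) (hN : 1 ≤ N) (m : ℕ) (hm : 1 ≤ m)
    (a : ℕ → ℝ) (ha : ∀ t ≤ m, 0 ≤ a t)
    (hrec : ∀ t < m, a (t + 1) ≤ 1 / κ * (a t + a 0) * a t)
    (h0 : a 0 / κ ≤ (1 / 2 : ℝ) ^ (N + 1)) :
    ∀ t ≤ m, a t / κ ≤ (1 / 2 : ℝ) ^ ((1 + t) * N + 1) := by
  intro t
  induction t with
  | zero => intro _; simpa using h0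
  | succ t ih =>
    intro ht
    have ih' := ih (by omega)
    have hr := hrec t (by omega)
    have hb : 0 ≤ a t / κ := div_nonneg (ha t (by omega)) hκ.le
    have hle : (1 / 2 : ℝ) ^ ((1 + t) * N + 1) ≤ (1 / 2 : ℝ) ^ (N + 1) := by
      apply pow_le_pow_of_le_one (by norm_num) (by norm_num)
      nlinarith [Nat.zero_le (t * N)]
    have hsum : a t / κ + a 0 / κ ≤ (1 / 2 : ℝ) ^ N := by
      have : (1 / 2 : ℝ) ^ (N + 1) = (1 / 2 : ℝ) ^ N * (1 / 2) := pow_succ _ _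
      linarith
    calc a (t + 1) / κ ≤ (1 / κ * (a t + a 0) * a t) / κ := by gcongr
      _ = (a t / κ + a 0 / κ) * (a t / κ) := by field_simp
      _ ≤ (1 / 2 : ℝ) ^ N * (1 / 2 : ℝ) ^ ((1 + t) * N + 1) := by gcongr
      _ = (1 / 2 : ℝ) ^ ((1 + (t + 1)) * N + 1) := by
        rw [← pow_add]
        congr 1
        ring
end
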